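/- Let k ≥ 1, let A_i, B_{i1}, …, B_{ik} ∈ ℂ^{m_i×n_i} for 1 ≤ i ≤ k, set N = n_1 ⋯ n_k, and for each i let [A_i, B_{i1}, …, B_{ik}] = U^i Σ^i (V^i)ᴴ be an SVD partitioned as in the context, with blocks V^i_{s,1} ∈ ℂ^{n_i×n_i} (1 ≤ s ≤ k+1). Assume ‖V^i_{1,1}‖₂ < 1 for every i. Suppose the multiparameter eigenvalue problem with coefficient matrices ((V^i_{1,1})ᴴ; (V^i_{2,1})ᴴ, …, (V^i_{k+1,1})ᴴ), 1 ≤ i ≤ k, possesses N eigen-tuples (λ_{1,j}, …, λ_{k,j}, x_{1,j}, …, x_{k,j}), j = 1, …, N, i.e. (V^i_{1,1})ᴴ x_{i,j} = Σ_{s=1}^k λ_{s,j} (V^i_{s+1,1})ᴴ x_{i,j} for all i, j with each x_{i,j} ≠ 0, such that the Kronecker products x_{1,j} ⊗ ⋯ ⊗ x_{k,j} (j = 1, …, N) are linearly independent. Then θ̃_N = φ. -/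

import Mathlib

open scoped BigOperators
open Matrix

noncomputable section

/-- Squared Frobenius norm of a complex matrix. -/
def frobSq {α β : Type} [Fintype α] [Fintype β] (M : Matrix α β ℂ) : ℝ :=
  ∑ i, ∑ j, ‖M i j‖ ^ 2

/-- Squared Euclidean norm of a complex vector. -/
def vecNormSq {α : Type} [Fintype α] (x : α → ℂ) : ℝ :=
  ∑ i, ‖x i‖ ^ 2

/-- Spectral norm (largest singular value) of a complex matrix. -/
def specNorm {α β : Type} [Fintype α] [Fintype β] (M : Matrix α β ℂ) : ℝ :=
  sSup {r : ℝ | ∃ x : β → ℂ, vecNormSq x = 1 ∧ r = Real.sqrt (vecNormSq (M.mulVec x))}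

/-- Horizontal concatenation `[A, B 0, B 1, …, B (k-1)]`; the column `(s, j)`
corresponds to column `s*n + j` (so columns of `A` come first). -/
def hcat {m n k : ℕ} (A : Matrix (Fin m) (Fin n) ℂ)
    (B : Fin k → Matrix (Fin m) (Fin n) ℂ) :
    Matrix (Fin m) (Fin (k + 1) × Fin n) ℂ :=
  Matrix.of fun i p => Fin.cases (A i p.2) (fun s => B s i p.2) p.1

/-- The rectangular "diagonal" matrix of an SVD of `[A, B 1, …, B k]`. -/
def svdSigma (m n k : ℕ) (σ : Fin (min m ((k + 1) * n)) → ℝ) :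
    Matrix (Fin (min m ((k + 1) * n))) (Fin (k + 1) × Fin n) ℂ :=
  Matrix.of fun i p =>
    if (i : ℕ) = (p.1 : ℕ) * n + (p.2 : ℕ) then ((σ i : ℝ) : ℂ) else 0

/-- The `n × n` block `V_{s,1}` of `V`, consisting of rows `(s−1)n+1, …, sn`
and columns `1, …, n`. -/
def Vblk {n k : ℕ} (V : Matrix (Fin (k + 1) × Fin n) (Fin (k + 1) × Fin n) ℂ)
    (s : Fin (k + 1)) : Matrix (Fin n) (Fin n) ℂ :=
  Matrix.of fun a b => V (s, a) ((0 : Fin (k + 1)), b)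

theorem frobSq_nonneg {α β : Type} [Fintype α] [Fintype β] (M : Matrix α β ℂ) :
    0 ≤ frobSq M :=
  Finset.sum_nonneg fun _ _ => Finset.sum_nonneg fun _ _ => sq_nonneg _

theorem ofReal_frobSq {α β : Type} [Fintype α] [Fintype β] (M : Matrix α β ℂ) :
    (frobSq M : ℂ) = (Mᴴ * M).trace := by
  simp only [frobSq, Matrix.trace, Matrix.diag, Matrix.mul_apply, Matrix.conjTranspose_apply]
  rw [Finset.sum_comm]
  push_cast
  refine Finset.sum_congr rfl fun j _ => Finset.sum_congr rfl fun i _ => ?_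
  rw [← Complex.conj_mul']
  rfl

theorem ofReal_vecNormSq {α : Type} [Fintype α] (x : α → ℂ) :
    (vecNormSq x : ℂ) = star x ⬝ᵥ x := by
  simp only [vecNormSq, dotProduct, Pi.star_apply]
  push_cast
  refine Finset.sum_congr rfl fun i _ => ?_
  rw [← Complex.conj_mul']
  rfl

/-- Left multiplication by a matrix with orthonormal columns preserves the Frobenius norm. -/
theorem frobSq_isometry_mul {α β γ : Type} [Fintype α] [Fintype β] [Fintype γ] [DecidableEq β]
    (U : Matrix α β ℂ) (hU : Uᴴ * U = 1) (M : Matrix β γ ℂ) :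
    frobSq (U * M) = frobSq M := by
  apply Complex.ofReal_injective
  rw [ofReal_frobSq, ofReal_frobSq, Matrix.conjTranspose_mul, Matrix.mul_assoc,
    ← Matrix.mul_assoc Uᴴ, hU, Matrix.one_mul]

/-- Pythagoras for the projection of the rows onto the span of orthonormal columns. -/
theorem frobSq_eq_add_of_isometry {α β γ : Type} [Fintype α] [Fintype β] [Fintype γ]
    [DecidableEq γ] (M : Matrix α β ℂ) (Q : Matrix β γ ℂ) (hQ : Qᴴ * Q = 1) :
    frobSq M = frobSq (M * Q) + frobSq (M - M * Q * Qᴴ) := by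
  apply Complex.ofReal_injective
  push_cast
  simp only [ofReal_frobSq]
  have h1 : (M - M * Q * Qᴴ)ᴴ * (M - M * Q * Qᴴ) =
      Mᴴ * M - Mᴴ * M * Q * Qᴴ - Q * (Qᴴ * Mᴴ * M) + Q * (Qᴴ * Mᴴ * M * Q * Qᴴ) := by
    simp only [Matrix.conjTranspose_sub, Matrix.conjTranspose_mul,
      Matrix.conjTranspose_conjTranspose, Matrix.mul_sub, Matrix.sub_mul, Matrix.mul_assoc]
    abel
  have e1 : (Mᴴ * M * Q * Qᴴ).trace = (Qᴴ * Mᴴ * M * Q).trace := by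
    rw [Matrix.trace_mul_comm]
    simp only [Matrix.mul_assoc]
  have e2 : (Q * (Qᴴ * Mᴴ * M)).trace = (Qᴴ * Mᴴ * M * Q).trace := Matrix.trace_mul_comm _ _
  have e3 : (Q * (Qᴴ * Mᴴ * M * Q * Qᴴ)).trace = (Qᴴ * Mᴴ * M * Q).trace := by
    rw [Matrix.trace_mul_comm, Matrix.mul_assoc _ Qᴴ Q, hQ, Matrix.mul_one]
  have e4 : ((M * Q)ᴴ * (M * Q)).trace = (Qᴴ * Mᴴ * M * Q).trace := by
    simp only [Matrix.conjTranspose_mul, Matrix.mul_assoc]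
  rw [h1, Matrix.trace_add, Matrix.trace_sub, Matrix.trace_sub, e1, e2, e3, e4]
  ring

/-- The rows of a matrix with orthonormal columns have norm at most one. -/
theorem row_normSq_le_one_of_isometry {β γ : Type} [Fintype β] [Fintype γ] [DecidableEq γ]
    (Y : Matrix β γ ℂ) (hY : Yᴴ * Y = 1) (p : β) : ∑ j, ‖Y p j‖ ^ 2 ≤ 1 := by
  set d := ∑ j, ‖Y p j‖ ^ 2 with hd
  set Z := Y * Yᴴ with hZ
  have hZZ : Z * Zᴴ = Z := by
    rw [hZ, Matrix.conjTranspose_mul, Matrix.conjTranspose_conjTranspose, Matrix.mul_assoc,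
      ← Matrix.mul_assoc Yᴴ, hY, Matrix.one_mul]
  have hdiag : Z p p = (d : ℂ) := by
    rw [hZ, hd, Matrix.mul_apply]
    push_cast
    refine Finset.sum_congr rfl fun j _ => ?_
    rw [← Complex.mul_conj']
    rfl
  have hsum : d = ∑ q, ‖Z p q‖ ^ 2 := by
    apply Complex.ofReal_injective
    rw [← hdiag]
    nth_rewrite 1 [← hZZ]
    rw [Matrix.mul_apply]
    push_cast
    refine Finset.sum_congr rfl fun j _ => ?_
    rw [← Complex.mul_conj']
    rfl
  have hd0 : 0 ≤ d := Finset.sum_nonneg fun _ _ => sq_nonneg _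
  have hle : d ^ 2 ≤ d := by
    have h := Finset.single_le_sum (f := fun q => ‖Z p q‖ ^ 2) (fun _ _ => sq_nonneg _)
      (Finset.mem_univ p)
    simp only [hdiag, Complex.norm_real, Real.norm_eq_abs, sq_abs] at h
    linarith
  by_contra! h
  nlinarith

open scoped ComplexOrder in
/-- The row space of a matrix of rank `r` has an orthonormal basis of size `r`. -/
theorem exists_isometry_mul_eq_self {α β : Type} [Fintype α] [Fintype β] [DecidableEq α]
    (C : Matrix α β ℂ) :
    ∃ Q : Matrix β (Fin C.rank) ℂ, Qᴴ * Q = 1 ∧ C * Q * Qᴴ = C := by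
  classical
  set S : Submodule ℂ (EuclideanSpace ℂ β) :=
    Submodule.span ℂ (Set.range fun i => WithLp.toLp 2 (Cᴴ.col i)) with hS
  have hr : Module.finrank ℂ S = C.rank := by
    rw [← Matrix.rank_conjTranspose, Matrix.rank_eq_finrank_span_cols, hS]
    have := LinearEquiv.finrank_map_eq (WithLp.linearEquiv 2 ℂ (β → ℂ)) S
    rw [← this, hS, Submodule.map_span, ← Set.range_comp]
    rfl
  set b := (stdOrthonormalBasis ℂ S).reindex (finCongr hr) with hb
  refine ⟨Matrix.of fun p j => (b j : EuclideanSpace ℂ β) p, ?_, ?_⟩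
  · ext i j
    have h := orthonormal_iff_ite.mp b.orthonormal i j
    rw [Submodule.coe_inner, PiLp.inner_apply] at h
    simp only [Matrix.mul_apply, Matrix.conjTranspose_apply, Matrix.of_apply, Matrix.one_apply]
    rw [← h]
    refine Finset.sum_congr rfl fun p _ => ?_
    simp [mul_comm]
  · ext i p
    have hmem : WithLp.toLp 2 (Cᴴ.col i) ∈ S := Submodule.subset_span ⟨i, rfl⟩
    have h := congrArg (fun v : S => (v : EuclideanSpace ℂ β) p) (b.sum_repr' ⟨_, hmem⟩)
    simp only [Submodule.coe_sum, Submodule.coe_smul, Submodule.coe_inner, PiLp.inner_apply,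
      WithLp.ofLp_sum, WithLp.ofLp_smul, Finset.sum_apply, Pi.smul_apply, smul_eq_mul,
      Matrix.col_apply, Matrix.conjTranspose_apply] at h
    have h2 := congrArg star h
    rw [star_star] at h2
    rw [← h2]
    simp only [Matrix.mul_apply, Matrix.conjTranspose_apply, Matrix.of_apply, star_sum, star_mul']
    refine Finset.sum_congr rfl fun j _ => ?_
    congr 1
    refine Finset.sum_congr rfl fun q _ => ?_
    simp

/-- The squared singular value attached to column `p` of `svdSigma`, zero when there is none. -/
def colSq (m n k : ℕ) (σ : Fin (min m ((k + 1) * n)) → ℝ) (p : Fin (k + 1) × Fin n) : ℝ :=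
  if h : (p.1 : ℕ) * n + (p.2 : ℕ) < min m ((k + 1) * n) then σ ⟨_, h⟩ ^ 2 else 0

theorem colSq_nonneg (m n k : ℕ) (σ : Fin (min m ((k + 1) * n)) → ℝ)
    (p : Fin (k + 1) × Fin n) : 0 ≤ colSq m n k σ p := by
  unfold colSq
  split_ifs <;> positivity

theorem colSq_anti (m n k : ℕ) (σ : Fin (min m ((k + 1) * n)) → ℝ)
    (h0 : ∀ j, 0 ≤ σ j) (hm : ∀ j₁ j₂, j₁ ≤ j₂ → σ j₂ ≤ σ j₁)
    {p q : Fin (k + 1) × Fin n} (hp : p.1 = 0) (hq : q.1 ≠ 0) :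
    colSq m n k σ q ≤ colSq m n k σ p := by
  have hle : (p.1 : ℕ) * n + (p.2 : ℕ) ≤ (q.1 : ℕ) * n + (q.2 : ℕ) := by
    have h1 : 1 ≤ (q.1 : ℕ) := Nat.one_le_iff_ne_zero.mpr fun h => hq (Fin.ext h)
    have h2 := Nat.mul_le_mul_right n h1
    have h3 := p.2.isLt
    rw [hp]
    simp only [Fin.val_zero]
    omega
  by_cases hlt : (q.1 : ℕ) * n + (q.2 : ℕ) < min m ((k + 1) * n)
  · have hlt' := lt_of_le_of_lt hle hlt
    simp only [colSq, dif_pos hlt, dif_pos hlt']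
    exact pow_le_pow_left₀ (h0 _) (hm _ _ hle) 2
  · calc colSq m n k σ q = 0 := by simp only [colSq, dif_neg hlt]
      _ ≤ _ := colSq_nonneg m n k σ p

theorem svdSigma_mul_apply {γ : Type} (m n k : ℕ) (σ : Fin (min m ((k + 1) * n)) → ℝ)
    (Y : Matrix (Fin (k + 1) × Fin n) γ ℂ) (p : Fin (k + 1) × Fin n)
    (h : (p.1 : ℕ) * n + (p.2 : ℕ) < min m ((k + 1) * n)) (j : γ) :
    (svdSigma m n k σ * Y) ⟨_, h⟩ j = σ ⟨_, h⟩ * Y p j := by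
  rw [Matrix.mul_apply, Finset.sum_eq_single p]
  · simp [svdSigma]
  · intro q _ hqp
    have hne : ¬ ((p.1 : ℕ) * n + (p.2 : ℕ) = (q.1 : ℕ) * n + (q.2 : ℕ)) := by
      intro he
      apply hqp
      apply finProdFinEquiv.injective
      apply Fin.ext
      simp only [finProdFinEquiv_apply_val]
      rw [Nat.mul_comm n, Nat.mul_comm n]
      omega
    simp [svdSigma, hne]
  · simp

theorem frobSq_svdSigma_mul {γ : Type} [Fintype γ] (m n k : ℕ)
    (σ : Fin (min m ((k + 1) * n)) → ℝ) (Y : Matrix (Fin (k + 1) × Fin n) γ ℂ) :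
    frobSq (svdSigma m n k σ * Y) = ∑ p, colSq m n k σ p * ∑ j, ‖Y p j‖ ^ 2 := by
  classical
  let idx : Fin (k + 1) × Fin n → ℕ := fun p => (p.1 : ℕ) * n + (p.2 : ℕ)
  unfold frobSq
  symm
  rw [← Finset.sum_filter_add_sum_filter_not Finset.univ
    (fun p => idx p < min m ((k + 1) * n)),
    Finset.sum_eq_zero (s := Finset.univ.filter fun p => ¬ idx p < min m ((k + 1) * n)), add_zero]
  · refine Finset.sum_bij (fun p hp => ⟨idx p, (Finset.mem_filter.mp hp).2⟩) ?_ ?_ ?_ ?_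
    · simp
    · intro p _ q _ he
      have he : (p.1 : ℕ) * n + (p.2 : ℕ) = (q.1 : ℕ) * n + (q.2 : ℕ) := congrArg Fin.val he
      apply finProdFinEquiv.injective
      apply Fin.ext
      simp only [finProdFinEquiv_apply_val]
      rw [Nat.mul_comm n, Nat.mul_comm n]
      omega
    · intro i _
      have hi : (i : ℕ) < (k + 1) * n := lt_of_lt_of_le i.isLt (min_le_right _ _)
      set p := finProdFinEquiv.symm (⟨i, hi⟩ : Fin ((k + 1) * n)) with hp
      have hv : idx p = i := by
        have := congrArg Fin.val (finProdFinEquiv.apply_symm_apply (⟨i, hi⟩ : Fin ((k + 1) * n)))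
        rw [← hp, finProdFinEquiv_apply_val, Nat.mul_comm n] at this
        simp only [idx]
        simp only at this
        omega
      exact ⟨p, Finset.mem_filter.mpr ⟨Finset.mem_univ _, hv ▸ i.isLt⟩, Fin.ext hv⟩
    · intro p hp
      have hlt := (Finset.mem_filter.mp hp).2
      have hc : colSq m n k σ p = σ ⟨idx p, hlt⟩ ^ 2 := dif_pos hlt
      rw [hc, Finset.mul_sum]
      refine Finset.sum_congr rfl fun j _ => ?_
      rw [svdSigma_mul_apply m n k σ Y p hlt j, norm_mul, mul_pow, Complex.norm_real,
        Real.norm_eq_abs, sq_abs]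
  · intro p hp
    have hlt := (Finset.mem_filter.mp hp).2
    have hc : colSq m n k σ p = 0 := dif_neg hlt
    rw [hc, zero_mul]

/-- A weighted sum with weights in `[0, 1]` of total at most the size of a block of largest
values is at most the sum over that block. -/
theorem sum_mul_le_sum_block {ι : Type} [Fintype ι] (P : ι → Prop) [DecidablePred P]
    (s d : ι → ℝ) (hs : ∀ p, 0 ≤ s p) (hsP : ∀ p q, P p → ¬ P q → s q ≤ s p)
    (hd0 : ∀ p, 0 ≤ d p) (hd1 : ∀ p, d p ≤ 1)
    (hd : ∑ p, d p ≤ ((Finset.univ.filter P).card : ℝ)) :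
    ∑ p, s p * d p ≤ ∑ p, s p * (if P p then 1 else 0) := by
  obtain ⟨τ, hτ0, hτ1, hτ2⟩ : ∃ τ : ℝ, 0 ≤ τ ∧ (∀ p, P p → τ ≤ s p) ∧
      (∀ q, ¬ P q → s q ≤ τ) := by
    by_cases hne : ∃ q, ¬ P q
    · obtain ⟨q, hq, hmax⟩ := Finset.exists_max_image (Finset.univ.filter fun q => ¬ P q) s
        (by obtain ⟨q, hq⟩ := hne; exact ⟨q, by simp [hq]⟩)
      exact ⟨s q, hs q, fun p hp => hsP p q hp (by simpa using hq),
        fun r hr => hmax r (by simp [hr])⟩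
    · push Not at hne
      exact ⟨0, le_rfl, fun p _ => hs p, fun q hq => absurd (hne q) hq⟩
  have hpt : ∀ p, τ * ((if P p then 1 else 0) - d p) ≤ s p * ((if P p then 1 else 0) - d p) := by
    intro p
    split_ifs with h
    · exact mul_le_mul_of_nonneg_right (hτ1 p h) (sub_nonneg.mpr (hd1 p))
    · nlinarith [hτ2 p h, hd0 p]
  have hsum := Finset.sum_le_sum fun p (_ : p ∈ Finset.univ) => hpt p
  have hcard : ∑ p, (if P p then (1 : ℝ) else 0) = ((Finset.univ.filter P).card : ℝ) := by
    simp
  rw [← Finset.mul_sum, Finset.sum_sub_distrib, hcard] at hsum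
  simp only [mul_sub, Finset.sum_sub_distrib] at hsum
  nlinarith [mul_nonneg hτ0 (sub_nonneg.mpr hd)]

/-- The first `n` columns of `V`. -/
def leadCols {n k : ℕ} (V : Matrix (Fin (k + 1) × Fin n) (Fin (k + 1) × Fin n) ℂ) :
    Matrix (Fin (k + 1) × Fin n) (Fin n) ℂ :=
  V.submatrix id fun b => (0, b)

theorem conjTranspose_leadCols_mul {n k : ℕ}
    (V : Matrix (Fin (k + 1) × Fin n) (Fin (k + 1) × Fin n) ℂ) (hV : Vᴴ * V = 1) :
    (leadCols V)ᴴ * leadCols V = 1 := by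
  ext a b
  have h := congrFun (congrFun hV (0, a)) (0, b)
  simpa [Matrix.mul_apply, leadCols, Matrix.one_apply] using h

theorem conjTranspose_mul_leadCols_apply {n k : ℕ}
    (V : Matrix (Fin (k + 1) × Fin n) (Fin (k + 1) × Fin n) ℂ) (hV : Vᴴ * V = 1)
    (p : Fin (k + 1) × Fin n) (b : Fin n) :
    (Vᴴ * leadCols V) p b = if p = (0, b) then 1 else 0 := by
  have h := congrFun (congrFun hV p) (0, b)
  simpa [Matrix.mul_apply, leadCols, Matrix.one_apply] using h

/-- Projecting onto the leading right singular vectors captures the most Frobenius norm. -/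
theorem frobSq_mul_isometry_le {m n k r : ℕ} (hr : r ≤ n)
    (M : Matrix (Fin m) (Fin (k + 1) × Fin n) ℂ)
    (U : Matrix (Fin m) (Fin (min m ((k + 1) * n))) ℂ)
    (σ : Fin (min m ((k + 1) * n)) → ℝ)
    (V : Matrix (Fin (k + 1) × Fin n) (Fin (k + 1) × Fin n) ℂ)
    (hU : Uᴴ * U = 1) (hV : Vᴴ * V = 1)
    (h0 : ∀ j, 0 ≤ σ j) (hm : ∀ j₁ j₂, j₁ ≤ j₂ → σ j₂ ≤ σ j₁)
    (hM : M = U * svdSigma m n k σ * Vᴴ)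
    (Q : Matrix (Fin (k + 1) × Fin n) (Fin r) ℂ) (hQ : Qᴴ * Q = 1) :
    frobSq (M * Q) ≤ frobSq (M * leadCols V) := by
  have key : ∀ {γ : Type} [Fintype γ] (T : Matrix (Fin (k + 1) × Fin n) γ ℂ),
      frobSq (M * T) = ∑ p, colSq m n k σ p * ∑ j, ‖(Vᴴ * T) p j‖ ^ 2 := by
    intro γ _ T
    rw [hM, Matrix.mul_assoc, Matrix.mul_assoc, frobSq_isometry_mul U hU, frobSq_svdSigma_mul]
  have hVV : V * Vᴴ = 1 := mul_eq_one_comm.mp hV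
  have hY : (Vᴴ * Q)ᴴ * (Vᴴ * Q) = 1 := by
    rw [Matrix.conjTranspose_mul, Matrix.conjTranspose_conjTranspose, Matrix.mul_assoc,
      ← Matrix.mul_assoc V, hVV, Matrix.one_mul, hQ]
  have hW : ∀ p : Fin (k + 1) × Fin n,
      ∑ j, ‖(Vᴴ * leadCols V) p j‖ ^ 2 = if p.1 = 0 then 1 else 0 := by
    rintro ⟨a, c⟩
    simp only [conjTranspose_mul_leadCols_apply V hV, Prod.mk.injEq]
    by_cases ha : a = 0
    · simp [ha, apply_ite, ite_pow]
    · simp [ha]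
  rw [key, key]
  simp only [hW]
  refine sum_mul_le_sum_block (fun p : Fin (k + 1) × Fin n => p.1 = 0) _ _
    (colSq_nonneg m n k σ) (fun p q hp hq => colSq_anti m n k σ h0 hm hp hq)
    (fun p => Finset.sum_nonneg fun _ _ => sq_nonneg _)
    (row_normSq_le_one_of_isometry _ hY) ?_
  have hcard : (Finset.univ.filter fun p : Fin (k + 1) × Fin n => p.1 = 0).card = n := by
    have : (Finset.univ.filter fun p : Fin (k + 1) × Fin n => p.1 = 0) =
        {(0 : Fin (k + 1))} ×ˢ Finset.univ := by
      ext ⟨a, b⟩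
      simp [eq_comm]
    rw [this, Finset.card_product]
    simp
  have htot : ∑ p, ∑ j, ‖(Vᴴ * Q) p j‖ ^ 2 = (r : ℝ) := by
    apply Complex.ofReal_injective
    change ((frobSq (Vᴴ * Q) : ℝ) : ℂ) = _
    rw [ofReal_frobSq, hY]
    simp
  rw [hcard, htot]
  exact_mod_cast hr

/-- Eckart–Young in the Frobenius norm. -/
theorem frobSq_sub_truncation_le {m n k : ℕ}
    (M : Matrix (Fin m) (Fin (k + 1) × Fin n) ℂ)
    (U : Matrix (Fin m) (Fin (min m ((k + 1) * n))) ℂ)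
    (σ : Fin (min m ((k + 1) * n)) → ℝ)
    (V : Matrix (Fin (k + 1) × Fin n) (Fin (k + 1) × Fin n) ℂ)
    (hU : Uᴴ * U = 1) (hV : Vᴴ * V = 1)
    (h0 : ∀ j, 0 ≤ σ j) (hm : ∀ j₁ j₂, j₁ ≤ j₂ → σ j₂ ≤ σ j₁)
    (hM : M = U * svdSigma m n k σ * Vᴴ)
    (C : Matrix (Fin m) (Fin (k + 1) × Fin n) ℂ) (hC : C.rank ≤ n) :
    frobSq (M * leadCols V * (leadCols V)ᴴ - M) ≤ frobSq (C - M) := by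
  obtain ⟨Q, hQ, hCQ⟩ := exists_isometry_mul_eq_self C
  have hneg : ∀ D : Matrix (Fin m) (Fin (k + 1) × Fin n) ℂ, frobSq (-D) = frobSq D := by
    simp [frobSq]
  have h1 := frobSq_eq_add_of_isometry M Q hQ
  have h2 := frobSq_eq_add_of_isometry M (leadCols V) (conjTranspose_leadCols_mul V hV)
  have h3 := frobSq_eq_add_of_isometry (C - M) Q hQ
  have h4 := frobSq_mul_isometry_le hC M U σ V hU hV h0 hm hM Q hQ
  have h5 : (C - M) - (C - M) * Q * Qᴴ = -(M - M * Q * Qᴴ) := by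
    rw [Matrix.sub_mul, Matrix.sub_mul, hCQ]
    abel
  rw [h5, hneg] at h3
  rw [← hneg, neg_sub]
  linarith [frobSq_nonneg ((C - M) * Q)]

theorem hcat_mul_conjTranspose_Vblk {m n k : ℕ} (T : Matrix (Fin m) (Fin n) ℂ)
    (V : Matrix (Fin (k + 1) × Fin n) (Fin (k + 1) × Fin n) ℂ) :
    hcat (T * (Vblk V 0)ᴴ) (fun s => T * (Vblk V s.succ)ᴴ) = T * (leadCols V)ᴴ := by
  ext i ⟨s, a⟩
  refine Fin.cases ?_ (fun s => ?_) s <;>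
    simp [hcat, Matrix.mul_apply, Vblk, leadCols]

theorem hcat_sub {m n k : ℕ} (A A' : Matrix (Fin m) (Fin n) ℂ)
    (B B' : Fin k → Matrix (Fin m) (Fin n) ℂ) :
    hcat (A - A') (fun s => B s - B' s) = hcat A B - hcat A' B' := by
  ext i ⟨s, a⟩
  refine Fin.cases ?_ (fun s => ?_) s <;> simp [hcat]

theorem vecNormSq_nonneg {α : Type} [Fintype α] (x : α → ℂ) : 0 ≤ vecNormSq x :=
  Finset.sum_nonneg fun _ _ => sq_nonneg _

theorem sum_conjTranspose_Vblk_mul {n k : ℕ}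
    (V : Matrix (Fin (k + 1) × Fin n) (Fin (k + 1) × Fin n) ℂ) (hV : Vᴴ * V = 1) :
    ∑ s, (Vblk V s)ᴴ * Vblk V s = 1 := by
  rw [← conjTranspose_leadCols_mul V hV]
  ext a b
  simp [Matrix.sum_apply, Matrix.mul_apply, Vblk, leadCols, Fintype.sum_prod_type]

theorem vecNormSq_eq_sum_Vblk {n k : ℕ}
    (V : Matrix (Fin (k + 1) × Fin n) (Fin (k + 1) × Fin n) ℂ) (hV : Vᴴ * V = 1)
    (x : Fin n → ℂ) : vecNormSq x = ∑ s, vecNormSq ((Vblk V s).mulVec x) := by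
  apply Complex.ofReal_injective
  push_cast
  simp only [ofReal_vecNormSq]
  have : ∀ s, star ((Vblk V s).mulVec x) ⬝ᵥ (Vblk V s).mulVec x =
      star x ⬝ᵥ ((Vblk V s)ᴴ * Vblk V s).mulVec x := by
    intro s
    rw [Matrix.star_mulVec, ← Matrix.dotProduct_mulVec, Matrix.mulVec_mulVec]
  simp only [this]
  rw [← dotProduct_sum, ← Matrix.sum_mulVec, sum_conjTranspose_Vblk_mul V hV, Matrix.one_mulVec]

theorem vecNormSq_mulVec_Vblk_zero_lt {n k : ℕ}
    (V : Matrix (Fin (k + 1) × Fin n) (Fin (k + 1) × Fin n) ℂ) (hV : Vᴴ * V = 1)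
    (hspec : specNorm (Vblk V 0) < 1) (x : Fin n → ℂ) (hx : x ≠ 0) :
    vecNormSq ((Vblk V 0).mulVec x) < vecNormSq x := by
  have hle : ∀ y, vecNormSq ((Vblk V 0).mulVec y) ≤ vecNormSq y := by
    intro y
    rw [vecNormSq_eq_sum_Vblk V hV y]
    exact Finset.single_le_sum (f := fun s => vecNormSq ((Vblk V s).mulVec y))
      (fun s _ => vecNormSq_nonneg _) (Finset.mem_univ 0)
  have hsmul : ∀ (c : ℝ) {α : Type} [Fintype α] (y : α → ℂ),
      vecNormSq ((c : ℂ) • y) = c ^ 2 * vecNormSq y := by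
    intro c α _ y
    simp [vecNormSq, Finset.mul_sum, mul_pow]
  have hpos : 0 < vecNormSq x := by
    obtain ⟨i, hi⟩ := Function.ne_iff.mp hx
    have := Finset.single_le_sum (f := fun i => ‖x i‖ ^ 2) (fun _ _ => sq_nonneg _)
      (Finset.mem_univ i)
    exact lt_of_lt_of_le (pow_pos (norm_pos_iff.mpr hi) 2) this
  set c : ℝ := (Real.sqrt (vecNormSq x))⁻¹ with hc
  have hc2 : c ^ 2 * vecNormSq x = 1 := by
    rw [hc, inv_pow, Real.sq_sqrt hpos.le, inv_mul_cancel₀ hpos.ne']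
  have hc0 : 0 < c ^ 2 := by positivity
  have hmem : Real.sqrt (vecNormSq ((Vblk V 0).mulVec ((c : ℂ) • x))) ≤ specNorm (Vblk V 0) := by
    refine le_csSup ⟨1, ?_⟩ ⟨_, by rw [hsmul, hc2], rfl⟩
    rintro _ ⟨y, hy, rfl⟩
    exact Real.sqrt_le_one.mpr ((hle y).trans hy.le)
  have hlt := hmem.trans_lt hspec
  rw [Real.sqrt_lt' one_pos, Matrix.mulVec_smul, hsmul, one_pow, ← hc2] at hlt
  exact lt_of_mul_lt_mul_left hlt hc0.le

/-- When `‖V₁₁‖₂ < 1`, the block `V₁₁ᴴ` factors through the remaining blocks. -/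
theorem exists_conjTranspose_Vblk_zero_eq {n k : ℕ}
    (V : Matrix (Fin (k + 1) × Fin n) (Fin (k + 1) × Fin n) ℂ) (hV : Vᴴ * V = 1)
    (hspec : specNorm (Vblk V 0) < 1) :
    ∃ X : Fin k → Matrix (Fin n) (Fin n) ℂ,
      (Vblk V 0)ᴴ = ∑ s : Fin k, (Vblk V s.succ)ᴴ * X s := by
  set G : Matrix (Fin n) (Fin n) ℂ := ∑ s : Fin k, (Vblk V s.succ)ᴴ * Vblk V s.succ with hG
  have hG1 : (Vblk V 0)ᴴ * Vblk V 0 + G = 1 := by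
    rw [← sum_conjTranspose_Vblk_mul V hV, Fin.sum_univ_succ]
  have hdet : G.det ≠ 0 := by
    intro hd
    obtain ⟨x, hx, hGx⟩ := Matrix.exists_mulVec_eq_zero_iff.mpr hd
    have hlt := vecNormSq_mulVec_Vblk_zero_lt V hV hspec x hx
    have heq : vecNormSq ((Vblk V 0).mulVec x) = vecNormSq x := by
      apply Complex.ofReal_injective
      rw [ofReal_vecNormSq, ofReal_vecNormSq, Matrix.star_mulVec, ← Matrix.dotProduct_mulVec,
        Matrix.mulVec_mulVec, eq_sub_of_add_eq hG1, Matrix.sub_mulVec, hGx, sub_zero,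
        Matrix.one_mulVec]
    exact hlt.ne heq
  refine ⟨fun s => Vblk V s.succ * (G⁻¹ * (Vblk V 0)ᴴ), ?_⟩
  simp only [← Matrix.mul_assoc]
  rw [← Finset.sum_mul, ← Finset.sum_mul, ← hG, Matrix.mul_nonsing_inv _ hdet.isUnit,
    Matrix.one_mul]

/-- Theorem 5.5: if `‖Vⁱ₁₁‖₂ < 1` for all `i` and the truncated-SVD
multiparameter eigenvalue problem with coefficients `(Vⁱ₁₁)ᴴ, (Vⁱ₂₁)ᴴ, …`
has `N = n₁⋯n_k` eigen-tuples whose Kronecker products are linearly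
independent, then `θ̃_N = φ`. -/
theorem stmt9 (k : ℕ) (hk : 1 ≤ k) (m n : Fin k → ℕ)
    (N : ℕ) (hN : N = ∏ i, n i)
    (A : ∀ i, Matrix (Fin (m i)) (Fin (n i)) ℂ)
    (B : ∀ i, Fin k → Matrix (Fin (m i)) (Fin (n i)) ℂ)
    (U : ∀ i, Matrix (Fin (m i)) (Fin (min (m i) ((k + 1) * n i))) ℂ)
    (σ : ∀ i, Fin (min (m i) ((k + 1) * n i)) → ℝ)
    (V : ∀ i, Matrix (Fin (k + 1) × Fin (n i)) (Fin (k + 1) × Fin (n i)) ℂ)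
    (hU : ∀ i, (U i)ᴴ * U i = 1) (hV : ∀ i, (V i)ᴴ * V i = 1)
    (hσ0 : ∀ i j, 0 ≤ σ i j) (hσm : ∀ i j₁ j₂, j₁ ≤ j₂ → σ i j₂ ≤ σ i j₁)
    (hSVD : ∀ i, hcat (A i) (B i) = U i * svdSigma (m i) (n i) k (σ i) * (V i)ᴴ)
    (hspec : ∀ i, specNorm (Vblk (V i) 0) < 1)
    (lam : Fin k → Fin N → ℂ)
    (x : (i : Fin k) → Fin N → Fin (n i) → ℂ)
    (hx : ∀ i j, x i j ≠ 0)
    (heig : ∀ i j, (Vblk (V i) 0)ᴴ.mulVec (x i j) =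
        ∑ s : Fin k, lam s j • ((Vblk (V i) s.succ)ᴴ.mulVec (x i j)))
    (hLI : LinearIndependent ℂ
      (fun j : Fin N => fun f : ((i : Fin k) → Fin (n i)) => ∏ i, x i j (f i))) :
    sInf {t : ℝ |
      ∃ (Ah : ∀ i, Matrix (Fin (m i)) (Fin (n i)) ℂ)
        (Bh : ∀ i, Fin k → Matrix (Fin (m i)) (Fin (n i)) ℂ)
        (mu : Fin k → Fin N → ℂ)
        (y : (i : Fin k) → Fin N → Fin (n i) → ℂ),
        (∀ i j, (Ah i).mulVec (y i j) = ∑ s, mu s j • (Bh i s).mulVec (y i j)) ∧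
        LinearIndependent ℂ
          (fun j : Fin N => fun f : ((i : Fin k) → Fin (n i)) => ∏ i, y i j (f i)) ∧
        (∀ i, (hcat (Ah i) (Bh i)).rank ≤ n i) ∧
        t = ∑ i, frobSq (hcat (Ah i - A i) (fun s => Bh i s - B i s))} =
    sInf {t : ℝ |
      ∃ (Ah : ∀ i, Matrix (Fin (m i)) (Fin (n i)) ℂ)
        (Bh : ∀ i, Fin k → Matrix (Fin (m i)) (Fin (n i)) ℂ)
        (X : ∀ i, Fin k → Matrix (Fin (n i)) (Fin (n i)) ℂ),
        (∀ i, Ah i = ∑ s, Bh i s * X i s) ∧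
        (∀ i, (hcat (Ah i) (Bh i)).rank ≤ n i) ∧
        t = ∑ i, frobSq (hcat (Ah i - A i) (fun s => Bh i s - B i s))} := by
  let T : ∀ i, Matrix (Fin (m i)) (Fin (n i)) ℂ := fun i => hcat (A i) (B i) * leadCols (V i)
  let Ah : ∀ i, Matrix (Fin (m i)) (Fin (n i)) ℂ := fun i => T i * (Vblk (V i) 0)ᴴ
  let Bh : ∀ i, Fin k → Matrix (Fin (m i)) (Fin (n i)) ℂ :=
    fun i s => T i * (Vblk (V i) s.succ)ᴴ
  have hcatT : ∀ i, hcat (Ah i) (Bh i) = T i * (leadCols (V i))ᴴ :=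
    fun i => hcat_mul_conjTranspose_Vblk _ _
  have hrank : ∀ i, (hcat (Ah i) (Bh i)).rank ≤ n i := fun i => by
    rw [hcatT]
    exact (Matrix.rank_mul_le_left _ _).trans (Matrix.rank_le_width _)
  have hmin : ∀ (Ch : ∀ i, Matrix (Fin (m i)) (Fin (n i)) ℂ)
      (Dh : ∀ i, Fin k → Matrix (Fin (m i)) (Fin (n i)) ℂ),
      (∀ i, (hcat (Ch i) (Dh i)).rank ≤ n i) →
      ∑ i, frobSq (hcat (Ah i - A i) (fun s => Bh i s - B i s)) ≤
        ∑ i, frobSq (hcat (Ch i - A i) (fun s => Dh i s - B i s)) := by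
    intro Ch Dh h
    refine Finset.sum_le_sum fun i _ => ?_
    rw [hcat_sub, hcat_sub, hcatT]
    exact frobSq_sub_truncation_le _ (U i) (σ i) (V i) (hU i) (hV i) (hσ0 i) (hσm i) (hSVD i)
      _ (h i)
  choose X hX using fun i => exists_conjTranspose_Vblk_zero_eq (V i) (hV i) (hspec i)
  trans ∑ i, frobSq (hcat (Ah i - A i) (fun s => Bh i s - B i s))
  · refine IsLeast.csInf_eq ⟨⟨Ah, Bh, lam, x, ?_, hLI, hrank, rfl⟩, ?_⟩
    · intro i j
      simp only [Ah, Bh, ← Matrix.mulVec_mulVec]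
      rw [heig i j, Matrix.mulVec_sum]
      simp only [Matrix.mulVec_smul]
    · rintro _ ⟨Ch, Dh, _, _, _, _, h, rfl⟩
      exact hmin Ch Dh h
  · symm
    refine IsLeast.csInf_eq ⟨⟨Ah, Bh, X, ?_, hrank, rfl⟩, ?_⟩
    · intro i
      simp only [Ah, Bh, Matrix.mul_assoc]
      rw [hX i, Matrix.mul_sum]
    · rintro _ ⟨Ch, Dh, _, _, h, rfl⟩
      exact hmin Ch Dh h

end
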